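/- arXiv:math/0404229 — 2 statements merged into one kernel-verified Lean document; each statement's English description precedes it below -/
import Mathlib

section
/- Let ν : A → A′ be a homomorphism of associative unital rings, V a finitely generated projective A-module, and σ : V[F_μ] → V[F_μ] an A[F_μ]-linear map with ε(σ) : V → V an isomorphism. Then the induced A′[F_μ]-linear map 1⊗σ on A′[F_μ] ⊗_{A[F_μ]} V[F_μ] ≅ (A′ ⊗_A V)[F_μ] is injective, its augmentation equals the isomorphism 1 ⊗ ε(σ) : A′ ⊗_A V → A′ ⊗_A V, and A′[F_μ] ⊗_{A[F_μ]} coker(σ) is an F_μ-link module in Flk(A′). Hence A′[F_μ] ⊗_{A[F_μ]} − carries Flk(A) into Flk(A′). -/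
open Finsupp

noncomputable section

/-- The free group `F_μ` on `μ` generators. -/
abbrev FG (μ : ℕ) : Type := FreeGroup (Fin μ)

/-- The group ring `A[F_μ]`. -/
abbrev GR (μ : ℕ) (A : Type*) [Ring A] : Type _ := MonoidAlgebra A (FG μ)

/-- The augmentation ring homomorphism `ε : A[F_μ] → A` sending every element of `F_μ` to `1`. -/
def aug (μ : ℕ) (A : Type*) [Ring A] : GR μ A →+* A :=
  MonoidAlgebra.liftNCRingHom (RingHom.id A) 1 (fun x y => by simp)


section ExtMod

variable (μ : ℕ) (A : Type*) [Ring A]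
variable {V V' : Type*} [AddCommGroup V] [Module A V] [AddCommGroup V'] [Module A V']

/-- Left translation action of `F_μ` on `V[F_μ] = FG μ →₀ V`. -/
def shiftEnd : FG μ →* AddMonoid.End (FG μ →₀ V) where
  toFun g := Finsupp.mapDomain.addMonoidHom (fun h => g * h)
  map_one' := by
    apply AddMonoidHom.ext
    intro f
    show Finsupp.mapDomain (fun h => (1:FG μ) * h) f = f
    simp only [one_mul]
    exact Finsupp.mapDomain_id
  map_mul' g₁ g₂ := by
    apply AddMonoidHom.ext
    intro f
    show Finsupp.mapDomain (fun h => (g₁ * g₂) * h) f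
      = Finsupp.mapDomain (fun h => g₁ * h) (Finsupp.mapDomain (fun h => g₂ * h) f)
    rw [show (fun h => g₁ * g₂ * h) = (fun h => g₁ * h) ∘ (fun h => g₂ * h) from
      funext fun h => mul_assoc g₁ g₂ h, Finsupp.mapDomain_comp]

/-- The ring homomorphism `A[F_μ] →+* End(V[F_μ])` inducing the module structure on
`V[F_μ] = A[F_μ] ⊗_A V`, realised as `FG μ →₀ V`. -/
def extScalarHom : GR μ A →+* AddMonoid.End (FG μ →₀ V) :=
  MonoidAlgebra.liftNCRingHom (Module.toAddMonoidEnd A (FG μ →₀ V)) (shiftEnd μ)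
    (fun a g => by
      apply AddMonoidHom.ext
      intro f
      show a • (Finsupp.mapDomain _ f) = Finsupp.mapDomain _ (a • f)
      exact (Finsupp.mapDomain_smul a f).symm)

/-- The `A[F_μ]`-module structure on `V[F_μ] = FG μ →₀ V` induced from the `A`-module `V`. -/
instance extModule : Module (GR μ A) (FG μ →₀ V) :=
  Module.compHom (FG μ →₀ V) (extScalarHom μ A (V := V))

/-- The augmentation `ε(σ) : V → V'` of an `A[F_μ]`-linear map `σ : V[F_μ] → V'[F_μ]`,
obtained by applying `A ⊗_{A[F_μ]} -`. -/
def augMap (σ : (FG μ →₀ V) →ₗ[GR μ A] (FG μ →₀ V')) : V → V' :=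
  fun v => (σ (Finsupp.single 1 v)).sum fun _ w => w

end ExtMod


/-- `M` is an `F_μ`-link module over `A` (`M ∈ Flk(A)`): it admits a presentation
`0 → V[F_μ] →^σ V[F_μ] → M → 0` with `V` a finitely generated projective `A`-module and
the augmentation `ε(σ)` invertible. -/
def IsFlk (μ : ℕ) (A : Type u) [Ring A] (M : Type v) [AddCommGroup M]
    [Module (GR μ A) M] : Prop :=
  ∃ (V : Type u) (_ : AddCommGroup V) (_ : Module A V), Module.Finite A V ∧
    Module.Projective A V ∧
    ∃ (σ : (FG μ →₀ V) →ₗ[GR μ A] (FG μ →₀ V)) (p : (FG μ →₀ V) →ₗ[GR μ A] M),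
      Function.Injective σ ∧ Function.Surjective p ∧ LinearMap.range σ = LinearMap.ker p ∧
      Function.Bijective (augMap μ A σ)

section Fox

variable {μ : ℕ} {W : Type*} [AddCommGroup W]

lemma shiftEnd_single (g h : FG μ) (w : W) :
    shiftEnd μ g (single h w) = single (g * h) w :=
  Finsupp.mapDomain_single

lemma shiftEnd_one_apply (f : FG μ →₀ W) : shiftEnd μ 1 f = f := by
  rw [map_one]; rfl

lemma shiftEnd_mul_apply (g h : FG μ) (f : FG μ →₀ W) :
    shiftEnd μ (g * h) f = shiftEnd μ g (shiftEnd μ h f) := by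
  rw [map_mul]; rfl

/-- The sum of the coefficients of an element of `W[F_μ]`. -/
def augSum : (FG μ →₀ W) →+ W := Finsupp.liftAddHom fun _ => AddMonoidHom.id W

lemma augSum_single (g : FG μ) (w : W) : augSum (single g w) = w :=
  Finsupp.liftAddHom_apply_single _ _ _

lemma augSum_shiftEnd (g : FG μ) (f : FG μ →₀ W) : augSum (shiftEnd μ g f) = augSum f := by
  induction f using Finsupp.induction_linear with
  | zero => simp
  | add f₁ f₂ h₁ h₂ => simp only [map_add, h₁, h₂]
  | single h w => rw [shiftEnd_single, augSum_single, augSum_single]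

/-- The `k`-th Fox derivative of a word, with coefficients in `W`, normalised so that
`w·g - w = ∑ k, (z_k - 1) ∂_k (w·g)`. -/
def foxWord (k : Fin μ) : List (Fin μ × Bool) → W →+ (FG μ →₀ W)
  | [] => 0
  | x :: l => foxWord k l + if x = (k, true) then singleAddHom (FreeGroup.mk l)
      else if x = (k, false) then -(singleAddHom (FreeGroup.mk (x :: l)) : W →+ (FG μ →₀ W)) else 0

/-- The `k`-th Fox derivative on `W[F_μ]`. -/
def fox (k : Fin μ) : (FG μ →₀ W) →+ (FG μ →₀ W) :=
  Finsupp.liftAddHom fun g => foxWord k g.toWord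

lemma fox_single (k : Fin μ) (g : FG μ) (w : W) : fox k (single g w) = foxWord k g.toWord w :=
  Finsupp.liftAddHom_apply_single _ _ _

lemma of_mul_mk (j : Fin μ) (l : List (Fin μ × Bool)) :
    FreeGroup.of j * FreeGroup.mk l = FreeGroup.mk ((j, true) :: l) := by
  simp [FreeGroup.of, FreeGroup.mul_mk]

lemma of_mul_mk_false (j : Fin μ) (l : List (Fin μ × Bool)) :
    FreeGroup.of j * FreeGroup.mk ((j, false) :: l) = FreeGroup.mk l := by
  rw [of_mul_mk]
  exact Quot.sound (FreeGroup.Red.Step.not (L₁ := []) (x := j) (b := true))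

lemma single_mk_eq_add_foxWord (l : List (Fin μ × Bool)) (w : W) :
    single (FreeGroup.mk l) w = single 1 w +
      ∑ k, (shiftEnd μ (FreeGroup.of k) (foxWord k l w) - foxWord k l w) := by
  induction l with
  | nil => simp [foxWord, FreeGroup.one_eq_mk]
  | cons x l ih =>
    have key : ∑ k, (shiftEnd μ (FreeGroup.of k) (foxWord k (x :: l) w) - foxWord k (x :: l) w)
        = ∑ k, (shiftEnd μ (FreeGroup.of k) (foxWord k l w) - foxWord k l w)
          + (single (FreeGroup.mk (x :: l)) w - single (FreeGroup.mk l) w) := by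
      rw [← sub_eq_iff_eq_add', ← Finset.sum_sub_distrib, Finset.sum_eq_single x.1]
      · obtain ⟨j, b⟩ := x
        cases b
        · simp only [foxWord, shiftEnd_single, of_mul_mk_false, Prod.mk.injEq, Bool.false_eq_true,
            and_false, if_false, if_true, AddMonoidHom.add_apply, AddMonoidHom.neg_apply,
            singleAddHom_apply, map_add, map_neg]
          abel
        · simp only [foxWord, shiftEnd_single, of_mul_mk, if_true, AddMonoidHom.add_apply,
            singleAddHom_apply, map_add]
          abel
      · rintro k - hk
        have h : ∀ b, x ≠ (k, b) := by rintro b rfl; exact hk rfl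
        simp [foxWord, h]
      · simp
    rw [key, ← add_assoc, ← ih]
    abel

lemma eq_add_fox (f : FG μ →₀ W) :
    f = single 1 (augSum f) + ∑ k, (shiftEnd μ (FreeGroup.of k) (fox k f) - fox k f) := by
  induction f using Finsupp.induction_linear with
  | zero => simp
  | add f₁ f₂ h₁ h₂ =>
    conv_lhs => rw [h₁, h₂]
    simp only [map_add, Finsupp.single_add, Finset.sum_sub_distrib, Finset.sum_add_distrib]
    abel
  | single g w =>
    simp only [fox_single, augSum_single]
    conv_lhs => rw [← FreeGroup.mk_toWord (x := g)]
    exact single_mk_eq_add_foxWord _ _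

lemma toWord_of_mul (j : Fin μ) (g : FG μ) :
    (FreeGroup.of j * g).toWord = (j, true) :: g.toWord ∨
      g.toWord = (j, false) :: (FreeGroup.of j * g).toWord := by
  have h : (FreeGroup.of j * g).toWord = FreeGroup.reduce ((j, true) :: g.toWord) := by
    rw [FreeGroup.toWord_mul, FreeGroup.toWord_of, List.singleton_append]
  rw [h, FreeGroup.reduce.cons, FreeGroup.reduce_toWord]
  rcases g.toWord with _ | ⟨⟨i, b⟩, l⟩
  · simp
  · by_cases hb : j = i ∧ b = false
    · obtain ⟨rfl, rfl⟩ := hb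
      simp
    · left
      dsimp only
      rw [if_neg]
      rintro ⟨h₁, h₂⟩
      exact hb ⟨h₁, by simpa using h₂.symm⟩

lemma fox_shiftEnd_of (k j : Fin μ) (f : FG μ →₀ W) :
    fox k (shiftEnd μ (FreeGroup.of j) f) = fox k f + if j = k then f else 0 := by
  induction f using Finsupp.induction_linear with
  | zero => simp
  | add f₁ f₂ h₁ h₂ =>
    simp only [map_add, h₁, h₂]
    split_ifs <;> abel
  | single g w =>
    rw [shiftEnd_single, fox_single, fox_single]
    rcases toWord_of_mul j g with h | h
    · rw [h]
      by_cases hjk : j = k <;> simp [foxWord, FreeGroup.mk_toWord, hjk]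
    · have hg := congrArg FreeGroup.mk h
      rw [FreeGroup.mk_toWord] at hg
      rw [h]
      by_cases hjk : j = k
      · subst hjk
        simp [foxWord, ← hg]
      · simp [foxWord, hjk]

lemma foxWord_apply_of_length_lt (k : Fin μ) (l : List (Fin μ × Bool)) (w : W) (h : FG μ)
    (hl : l.length < h.norm) : foxWord k l w h = 0 := by
  have hne : ∀ l' : List (Fin μ × Bool), l'.length < h.norm → FreeGroup.mk l' ≠ h := by
    rintro l' hl' rfl
    exact absurd FreeGroup.norm_mk_le hl'.not_ge
  induction l with
  | nil => simp [foxWord]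
  | cons x l ih =>
    have hl' : l.length < h.norm := (Nat.lt_succ_self _).trans hl
    have h₁ := hne _ hl
    have h₂ := hne _ hl'
    simp only [foxWord, AddMonoidHom.add_apply, Finsupp.add_apply, ih hl', zero_add]
    split_ifs <;> simp [h₁, h₂]

lemma foxWord_toWord_apply (k : Fin μ) (g h : FG μ) (w : W) (hg : g.norm ≤ h.norm) :
    foxWord k g.toWord w h =
      if h.toWord.head? = some (k, false) then -(single g w h) else 0 := by
  have hmk : FreeGroup.mk g.toWord = g := FreeGroup.mk_toWord
  rcases hw : g.toWord with _ | ⟨x, l⟩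
  · by_cases hgh : g = h
    · subst hgh; simp [foxWord, hw]
    · simp [foxWord, hgh]
  · have hlen : l.length < h.norm := by
      have : g.norm = l.length + 1 := by simp [FreeGroup.norm, hw]
      omega
    have hne : FreeGroup.mk l ≠ h := by
      rintro rfl
      exact absurd FreeGroup.norm_mk_le hlen.not_ge
    rw [hw] at hmk
    simp only [foxWord, AddMonoidHom.add_apply, Finsupp.add_apply, hmk,
      foxWord_apply_of_length_lt k l w h hlen, zero_add]
    by_cases hgh : g = h
    · subst hgh
      rw [hw]
      split_ifs <;> simp_all
    · split_ifs <;> simp [hgh, hne]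

lemma fox_apply (k : Fin μ) (f : FG μ →₀ W) (h : FG μ)
    (hf : ∀ g, f g ≠ 0 → g.norm ≤ h.norm) :
    fox k f h = if h.toWord.head? = some (k, false) then -(f h) else 0 := by
  have h₁ : fox k f h = ∑ g ∈ f.support, foxWord k g.toWord (f g) h := by
    rw [← Finsupp.finsetSum_apply]; rfl
  have h₂ : f h = ∑ g ∈ f.support, single g (f g) h := by
    rw [← Finsupp.finsetSum_apply]
    exact congrArg (· h) f.sum_single.symm
  rw [h₁, Finset.sum_congr rfl fun g hg =>
    foxWord_toWord_apply k g h (f g) (hf g (Finsupp.mem_support_iff.mp hg))]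
  split_ifs
  · rw [Finset.sum_neg_distrib, ← h₂]
  · simp

/-- A finite set of group elements is suffix-closed if deleting the first letter of the reduced
word of an element stays in the set. -/
def SuffixClosed (S : Finset (FG μ)) : Prop :=
  ∀ g ∈ S, ∀ x l, g.toWord = x :: l → FreeGroup.mk l ∈ S

lemma toWord_mk_tail {g : FG μ} {x : Fin μ × Bool} {l : List (Fin μ × Bool)}
    (h : g.toWord = x :: l) : (FreeGroup.mk l).toWord = l := by
  rw [FreeGroup.toWord_mk]
  have hr : FreeGroup.IsReduced (x :: l) := h ▸ FreeGroup.isReduced_toWord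
  exact (hr.infix ⟨[x], [], by simp⟩).reduce_eq

lemma foxWord_toWord_apply_of_notMem {S : Finset (FG μ)} (hS : SuffixClosed S) (k : Fin μ)
    (l : List (Fin μ × Bool)) (g : FG μ) (hl : g.toWord = l) (hg : g ∈ S) (w : W)
    (h : FG μ) (hh : h ∉ S) : foxWord k l w h = 0 := by
  induction l generalizing g with
  | nil => simp [foxWord]
  | cons x l ih =>
    have hmem := hS g hg x l hl
    have h₁ : FreeGroup.mk l ≠ h := fun e => hh (e ▸ hmem)
    have h₂ : FreeGroup.mk (x :: l) ≠ h := by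
      rw [← hl, FreeGroup.mk_toWord]
      exact fun e => hh (e ▸ hg)
    simp only [foxWord, AddMonoidHom.add_apply, Finsupp.add_apply,
      ih _ (toWord_mk_tail hl) hmem, zero_add]
    split_ifs <;> simp [h₁, h₂]

lemma fox_apply_of_notMem {S : Finset (FG μ)} (hS : SuffixClosed S) (k : Fin μ)
    (f : FG μ →₀ W) (hf : ∀ g, g ∉ S → f g = 0) (h : FG μ) (hh : h ∉ S) : fox k f h = 0 := by
  have h₁ : fox k f h = ∑ g ∈ f.support, foxWord k g.toWord (f g) h := by
    rw [← Finsupp.finsetSum_apply]; rfl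
  rw [h₁]
  refine Finset.sum_eq_zero fun g hg => ?_
  refine foxWord_toWord_apply_of_notMem hS k _ g rfl ?_ _ h hh
  by_contra hgS
  exact Finsupp.mem_support_iff.mp hg (hf g hgS)

lemma SuffixClosed.erase {S : Finset (FG μ)} (hS : SuffixClosed S) {h : FG μ}
    (hmax : ∀ g ∈ S, g.norm ≤ h.norm) : SuffixClosed (S.erase h) := by
  intro g hg x l hl
  refine Finset.mem_erase.mpr ⟨?_, hS g (Finset.mem_of_mem_erase hg) x l hl⟩
  rintro rfl
  have h₁ := hmax g (Finset.mem_of_mem_erase hg)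
  have h₂ := FreeGroup.norm_mk_le (L₁ := l)
  have h₃ : g.norm = l.length + 1 := by simp [FreeGroup.norm, hl]
  omega

lemma exists_suffixClosed (f : FG μ →₀ W) :
    ∃ S : Finset (FG μ), SuffixClosed S ∧ ∀ g, g ∉ S → f g = 0 := by
  obtain ⟨N, hN⟩ : ∃ N, ∀ g ∈ f.support, g.norm ≤ N :=
    ⟨f.support.sup FreeGroup.norm, fun g hg => Finset.le_sup (f := FreeGroup.norm) hg⟩
  have hfin : {g : FG μ | g.norm ≤ N}.Finite :=
    ((List.finite_length_le (Fin μ × Bool) N).image FreeGroup.mk).subset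
      fun g hg => ⟨g.toWord, hg, FreeGroup.mk_toWord⟩
  refine ⟨hfin.toFinset, fun g hg x l hl => ?_, fun g hg => ?_⟩
  · simp only [Set.Finite.mem_toFinset, Set.mem_ofPred_eq] at hg ⊢
    have h₂ := FreeGroup.norm_mk_le (L₁ := l)
    have h₃ : g.norm = l.length + 1 := by simp [FreeGroup.norm, hl]
    omega
  · by_contra hne
    exact hg (by simpa using hN g (Finsupp.mem_support_iff.mpr hne))

/-- A subgroup of `W[F_μ]` stable under the Fox derivatives on which the augmentation vanishes
is trivial. -/
lemma eq_zero_of_fox_stable (K : AddSubgroup (FG μ →₀ W)) (haug : ∀ f ∈ K, augSum f = 0)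
    (hfox : ∀ k, ∀ f ∈ K, fox k f ∈ K) (f : FG μ →₀ W) (hf : f ∈ K) : f = 0 := by
  obtain ⟨S, hS, hfS⟩ := exists_suffixClosed f
  induction hn : S.card generalizing S f with
  | zero =>
    rw [Finset.card_eq_zero] at hn
    ext g
    exact hfS g (by simp [hn])
  | succ n ih =>
    obtain ⟨h, hhS, hmax⟩ := S.exists_max_image FreeGroup.norm (Finset.card_pos.mp (by omega))
    have ih' : ∀ f' ∈ K, (∀ g, g ∉ S → f' g = 0) → f' h = 0 → f' = 0 := by
      intro f' hf' hf'S hf'h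
      refine ih f' hf' (S.erase h) (hS.erase hmax) (fun g hg => ?_)
        (by rw [Finset.card_erase_of_mem hhS, hn]; rfl)
      by_cases hgh : g = h
      · rw [hgh, hf'h]
      · exact hf'S g fun hgS => hg (Finset.mem_erase.mpr ⟨hgh, hgS⟩)
    have hnorm : ∀ g, f g ≠ 0 → g.norm ≤ h.norm := fun g hg =>
      hmax g (by by_contra hgS; exact hg (hfS g hgS))
    have hzero : ∀ k, h.toWord.head? ≠ some (k, false) → fox k f = 0 := fun k hk =>
      ih' _ (hfox k f hf) (fox_apply_of_notMem hS k f hfS) (by rw [fox_apply k f h hnorm, if_neg hk])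
    have hf_eq := eq_add_fox f
    rw [haug f hf, Finsupp.single_zero, zero_add] at hf_eq
    by_cases hi : ∃ i, h.toWord.head? = some (i, false)
    · obtain ⟨i, hi⟩ := hi
      have hneg : f + fox i f = 0 :=
        ih' _ (K.add_mem hf (hfox i f hf))
          (fun g hg => by rw [Finsupp.add_apply, hfS g hg, fox_apply_of_notMem hS i f hfS g hg,
            add_zero])
          (by rw [Finsupp.add_apply, fox_apply i f h hnorm, if_pos hi, add_neg_cancel])
      have hfi : fox i f = -f := (neg_eq_of_add_eq_zero_right hneg).symm
      rw [Finset.sum_eq_single i, hfi, map_neg, sub_neg_eq_add, right_eq_add, neg_eq_zero] at hf_eq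
      · have := congrArg (shiftEnd μ (FreeGroup.of i)⁻¹) hf_eq
        rwa [map_zero, ← shiftEnd_mul_apply, inv_mul_cancel, shiftEnd_one_apply] at this
      · intro k _ hk
        have : fox k f = 0 := hzero k (by rw [hi]; simpa using Ne.symm hk)
        simp [this]
      · simp
    · rw [hf_eq]
      refine Finset.sum_eq_zero fun k _ => ?_
      simp [hzero k fun hk => hi ⟨k, hk⟩]

/-- An additive endomorphism of `W[F_μ]` commuting with the action of `F_μ` is injective as soon
as its augmentation is. -/
lemma injective_of_augSum_injective (s : (FG μ →₀ W) →+ (FG μ →₀ W))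
    (hs : ∀ g f, s (shiftEnd μ g f) = shiftEnd μ g (s f))
    (hinj : ∀ w, augSum (s (single 1 w)) = 0 → w = 0) : Function.Injective s := by
  have haug : ∀ f, augSum (s f) = augSum (s (single 1 (augSum f))) := by
    intro f
    induction f using Finsupp.induction_linear with
    | zero => simp
    | add f₁ f₂ h₁ h₂ => simp only [map_add, Finsupp.single_add, h₁, h₂]
    | single g w =>
      rw [augSum_single, ← augSum_shiftEnd g (s (single 1 w)), ← hs, shiftEnd_single, mul_one]
  have hker : ∀ f ∈ s.ker, augSum f = 0 := by
    intro f hf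
    apply hinj
    rw [← haug, (AddMonoidHom.mem_ker).mp hf, map_zero]
  rw [injective_iff_map_eq_zero]
  refine fun f hf => eq_zero_of_fox_stable s.ker hker (fun k f hf => ?_) f hf
  have h₁ := congrArg s (eq_add_fox f)
  rw [(AddMonoidHom.mem_ker).mp hf, hker f hf, Finsupp.single_zero, zero_add, map_sum] at h₁
  have h₂ := congrArg (fox k) h₁
  simp only [map_sub, hs, map_sum, fox_shiftEnd_of, add_sub_cancel_left, map_zero,
    Finset.sum_ite_eq', Finset.mem_univ, if_true] at h₂
  exact h₂.symm

end Fox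

section Action

variable {μ : ℕ} {A : Type*} [Ring A] {V V' : Type*} [AddCommGroup V] [Module A V]
  [AddCommGroup V'] [Module A V']

lemma single_smul_eq (g : FG μ) (a : A) (f : FG μ →₀ V) :
    (MonoidAlgebra.single g a : GR μ A) • f = a • shiftEnd μ g f := by
  exact congrArg (fun s : AddMonoid.End (FG μ →₀ V) => s f)
    (MonoidAlgebra.liftNC_single _ _ g a)

/-- An additive map `V[F_μ] → V'[F_μ]` commuting with the actions of `A` and `F_μ` is
`A[F_μ]`-linear. -/
def linearMapOfShift (s : (FG μ →₀ V) →+ (FG μ →₀ V'))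
    (hA : ∀ (a : A) f, s (a • f) = a • s f)
    (hF : ∀ g f, s (shiftEnd μ g f) = shiftEnd μ g (s f)) :
    (FG μ →₀ V) →ₗ[GR μ A] (FG μ →₀ V') where
  toFun := s
  map_add' := s.map_add
  map_smul' r f := by
    induction r using MonoidAlgebra.induction_linear with
    | zero => simp
    | add r₁ r₂ h₁ h₂ => simp only [add_smul, map_add, h₁, h₂]
    | single g a =>
      rw [RingHom.id_apply, single_smul_eq, single_smul_eq, hA, hF]

lemma map_shiftEnd (σ : (FG μ →₀ V) →ₗ[GR μ A] (FG μ →₀ V')) (g : FG μ) (f : FG μ →₀ V) :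
    σ (shiftEnd μ g f) = shiftEnd μ g (σ f) := by
  have h := σ.map_smul (MonoidAlgebra.single g 1) f
  rwa [single_smul_eq, single_smul_eq, one_smul, one_smul] at h

lemma map_coeff_smul (σ : (FG μ →₀ V) →ₗ[GR μ A] (FG μ →₀ V')) (a : A) (f : FG μ →₀ V) :
    σ (a • f) = a • σ f := by
  have h := σ.map_smul (MonoidAlgebra.single 1 a) f
  rwa [single_smul_eq, single_smul_eq, shiftEnd_one_apply, shiftEnd_one_apply] at h

lemma augSum_smul (a : A) (f : FG μ →₀ V) : augSum (a • f) = a • augSum f := by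
  induction f using Finsupp.induction_linear with
  | zero => simp
  | add f₁ f₂ h₁ h₂ => simp only [smul_add, map_add, h₁, h₂]
  | single g w => rw [Finsupp.smul_single, augSum_single, augSum_single]

lemma augMap_eq_augSum (σ : (FG μ →₀ V) →ₗ[GR μ A] (FG μ →₀ V')) (v : V) :
    augMap μ A σ v = augSum (σ (single 1 v)) := rfl

/-- The augmentation as an `A`-linear map. -/
def augLinearMap (σ : (FG μ →₀ V) →ₗ[GR μ A] (FG μ →₀ V')) : V →ₗ[A] V' where
  toFun := augMap μ A σ
  map_add' v w := by simp only [augMap_eq_augSum, Finsupp.single_add, map_add]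
  map_smul' a v := by
    simp only [augMap_eq_augSum, ← Finsupp.smul_single, map_coeff_smul, augSum_smul,
      RingHom.id_apply]

lemma injective_of_augMap_injective (σ : (FG μ →₀ V) →ₗ[GR μ A] (FG μ →₀ V))
    (hσ : Function.Injective (augMap μ A σ)) : Function.Injective σ :=
  injective_of_augSum_injective σ.toAddMonoidHom (map_shiftEnd σ) fun _ hw =>
    (injective_iff_map_eq_zero (augLinearMap σ)).mp hσ _ hw

lemma augSum_mapRange (t : V →+ V') (f : FG μ →₀ V) :
    augSum (Finsupp.mapRange t (map_zero t) f) = t (augSum f) := by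
  induction f using Finsupp.induction_linear with
  | zero => simp
  | add f₁ f₂ h₁ h₂ => rw [Finsupp.mapRange_add t.map_add, map_add, map_add, map_add, h₁, h₂]
  | single g w => rw [Finsupp.mapRange_single, augSum_single, augSum_single]

lemma mapRange_shiftEnd (t : V →+ V') (g : FG μ) (f : FG μ →₀ V) :
    Finsupp.mapRange.addMonoidHom t (shiftEnd μ g f) =
      shiftEnd μ g (Finsupp.mapRange.addMonoidHom t f) := by
  induction f using Finsupp.induction_linear with
  | zero => simp
  | add f₁ f₂ h₁ h₂ => simp only [map_add, h₁, h₂]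
  | single h w => simp [shiftEnd_single]

/-- The isomorphism `V[F_μ] ≅ V'[F_μ]` induced by an isomorphism `V ≅ V'`. -/
def mapRangeEquiv (μ : ℕ) (e : V ≃ₗ[A] V') : (FG μ →₀ V) ≃ₗ[GR μ A] (FG μ →₀ V') :=
  { linearMapOfShift (Finsupp.mapRange.addMonoidHom e.toLinearMap.toAddMonoidHom)
      (fun a f => (Finsupp.mapRange.linearMap e.toLinearMap).map_smul a f)
      (mapRange_shiftEnd _) with
    invFun := Finsupp.mapRange e.symm (map_zero e.symm)
    left_inv f := by ext g; exact e.symm_apply_apply (f g)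
    right_inv f := by ext g; exact e.apply_symm_apply (f g) }

lemma mapRangeEquiv_single (e : V ≃ₗ[A] V') (g : FG μ) (v : V) :
    mapRangeEquiv μ e (single g v) = single g (e v) :=
  Finsupp.mapRange_single (hf := map_zero e)

lemma augSum_mapRangeEquiv_symm (e : V ≃ₗ[A] V') (f : FG μ →₀ V') :
    augSum ((mapRangeEquiv μ e).symm f) = e.symm (augSum f) :=
  augSum_mapRange e.symm.toLinearMap.toAddMonoidHom f

end Action

/-- The cokernel of an endomorphism of `W[F_μ]` with invertible augmentation is a link module,
as soon as `W` is isomorphic to a finitely generated projective module. -/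
lemma isFlk_quotient_range {μ : ℕ} {A : Type u} [Ring A] {W : Type*} [AddCommGroup W] [Module A W]
    (P : Type u) [AddCommGroup P] [Module A P] [Module.Finite A P] [Module.Projective A P]
    (e : P ≃ₗ[A] W) (σ : (FG μ →₀ W) →ₗ[GR μ A] (FG μ →₀ W))
    (hσ : Function.Bijective (augMap μ A σ)) :
    IsFlk μ A ((FG μ →₀ W) ⧸ LinearMap.range σ) := by
  let E := mapRangeEquiv μ e
  refine ⟨P, _, _, inferInstance, inferInstance, E.symm.toLinearMap ∘ₗ σ ∘ₗ E.toLinearMap,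
    (LinearMap.range σ).mkQ ∘ₗ E.toLinearMap, ?_, ?_, ?_, ?_⟩
  · exact E.symm.injective.comp ((injective_of_augMap_injective σ hσ.injective).comp E.injective)
  · exact (Submodule.mkQ_surjective _).comp E.surjective
  · ext f
    simp only [LinearMap.mem_range, LinearMap.mem_ker, LinearMap.comp_apply,
      LinearEquiv.coe_coe, Submodule.mkQ_apply, Submodule.Quotient.mk_eq_zero]
    constructor
    · rintro ⟨x, rfl⟩
      exact ⟨E x, (E.apply_symm_apply _).symm⟩
    · rintro ⟨y, hy⟩
      exact ⟨E.symm y, by rw [E.apply_symm_apply, hy, E.symm_apply_apply]⟩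
  · have h : augMap μ A (E.symm.toLinearMap ∘ₗ σ ∘ₗ E.toLinearMap) =
        e.symm ∘ augMap μ A σ ∘ e := by
      funext v
      simp only [augMap_eq_augSum, LinearMap.comp_apply, LinearEquiv.coe_coe, E,
        augSum_mapRangeEquiv_symm, mapRangeEquiv_single, Function.comp_apply]
    rw [h]
    exact e.symm.bijective.comp (hσ.comp e.bijective)

section CoinducedCharacter

variable (R : Type*) [Ring R]

/-- The left `R`-module structure on `Hom_ℤ(R, ℚ/ℤ)` given by `(r • χ) a = χ (a * r)`. -/
@[reducible]
def characterModuleStructure : Module R (R →+ AddCircle (1 : ℚ)) where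
  smul r χ := χ.comp (AddMonoidHom.mulRight r)
  one_smul χ := by ext a; exact congrArg χ (mul_one a)
  mul_smul r s χ := by ext a; exact congrArg χ (mul_assoc a r s).symm
  smul_zero _ := rfl
  smul_add _ _ _ := rfl
  add_smul r s χ := by
    ext a
    exact (congrArg χ (mul_add a r s)).trans (χ.map_add _ _)
  zero_smul χ := by ext a; exact (congrArg χ (mul_zero a)).trans χ.map_zero

/-- The `R`-linear map `W → Hom_ℤ(R, ℚ/ℤ)` adjoint to a character of `W`. -/
def characterAdjoint {W : Type*} [AddCommGroup W] [Module R W] (χ : CharacterModule W) :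
    letI := characterModuleStructure R
    W →ₗ[R] (R →+ AddCircle (1 : ℚ)) :=
  letI := characterModuleStructure R
  { toFun := fun w => AddMonoidHom.comp (χ : W →+ AddCircle (1 : ℚ)) ((smulAddHom R W).flip w)
    map_add' := fun v w => by
      ext a
      exact (congrArg χ (smul_add a v w)).trans (map_add χ _ _)
    map_smul' := fun r w => by
      ext a
      exact congrArg χ (smul_smul a r w) }

end CoinducedCharacter

lemma linearCombination_section {A A' V U : Type*} [Ring A] [Ring A'] {ν : A →+* A'}
    [AddCommGroup V] [Module A V] [AddCommGroup U] [Module A' U] {n : ℕ}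
    (p : (Fin n → A) →ₗ[A] V) (i : V →ₗ[A] (Fin n → A)) (hpi : p ∘ₗ i = LinearMap.id)
    (f : V →ₛₗ[ν] U) (v : V) :
    Fintype.linearCombination A' (fun j => f (p (Pi.single j 1))) (fun j => ν (i v j)) = f v := by
  have hsum : ∑ j, i v j • p (Pi.single j 1) = v := by
    conv_rhs => rw [← LinearMap.id_apply (R := A) v, ← hpi, LinearMap.comp_apply,
      pi_eq_sum_univ' (i v)]
    simp [Pi.single]
  conv_rhs => rw [← hsum]
  simp [Fintype.linearCombination_apply, map_sum]

/-- A base change of a finitely generated projective module, given by its universal property among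
modules in the universe of the ring, is isomorphic to a finitely generated projective module in that
universe, and is spanned by the image of the original module. -/
lemma exists_small_baseChange {A : Type*} [Ring A] {A' : Type u'} [Ring A'] (ν : A →+* A')
    {V : Type*} [AddCommGroup V] [Module A V] [Module.Finite A V] [Module.Projective A V]
    {W : Type*} [AddCommGroup W] [Module A' W] (τ : V →ₛₗ[ν] W)
    (hW : ∀ (U : Type u') [AddCommGroup U] [Module A' U] (f : V →ₛₗ[ν] U),
      ∃! g : W →ₗ[A'] U, ∀ v, g (τ v) = f v) :
    Submodule.span A' (Set.range τ) = ⊤ ∧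
    ∃ (P : Type u') (_ : AddCommGroup P) (_ : Module A' P), Module.Finite A' P ∧
      Module.Projective A' P ∧ Nonempty (P ≃ₗ[A'] W) := by
  obtain ⟨n, p, i, -, -, hpi⟩ := Module.Finite.exists_comp_eq_id_of_projective A V
  let c : V →ₛₗ[ν] (Fin n → A') :=
    { toFun := fun v j => ν (i v j)
      map_add' := fun v w => by ext j; simp
      map_smul' := fun a v => by ext j; simp }
  let P : Submodule A' (Fin n → A') := Submodule.span A' (Set.range c)
  let τ₀ : V →ₛₗ[ν] P :=
    { toFun := fun v => ⟨c v, Submodule.subset_span ⟨v, rfl⟩⟩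
      map_add' := fun v w => by ext1; exact c.map_add v w
      map_smul' := fun a v => by ext1; exact c.map_smulₛₗ a v }
  have hspan : Submodule.span A' (Set.range τ₀) = ⊤ := by
    apply Submodule.map_injective_of_injective P.injective_subtype
    rw [Submodule.map_span, ← Set.range_comp, Submodule.map_subtype_top]
    rfl
  let r : (Fin n → A') →ₗ[A'] P :=
    Fintype.linearCombination A' fun j => τ₀ (p (Pi.single j 1))
  have hr : r ∘ₗ P.subtype = LinearMap.id :=
    LinearMap.ext_on_range hspan fun v => linearCombination_section p i hpi τ₀ v
  have hfin : Module.Finite A' P :=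
    Module.Finite.of_surjective r fun x => ⟨x, LinearMap.congr_fun hr x⟩
  have hproj : Module.Projective A' P := Module.Projective.of_split P.subtype r hr
  let h : P →ₗ[A'] W :=
    (Fintype.linearCombination A' fun j => τ (p (Pi.single j 1))) ∘ₗ P.subtype
  have hτ : ∀ v, h (τ₀ v) = τ v := linearCombination_section p i hpi τ
  obtain ⟨g, hg, -⟩ := hW P τ₀
  have hgh : g ∘ₗ h = LinearMap.id :=
    LinearMap.ext_on_range hspan fun v => by
      rw [LinearMap.comp_apply, hτ, hg, LinearMap.id_apply]
  have hhg : h ∘ₗ g = LinearMap.id := by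
    ext w
    refine (sub_eq_zero.mp (CharacterModule.eq_zero_of_character_apply fun χ => ?_)).symm
    let := characterModuleStructure A'
    let φ := characterAdjoint A' χ
    have hφ : φ = φ ∘ₗ h ∘ₗ g :=
      (hW (A' →+ AddCircle (1 : ℚ)) (φ.comp τ)).unique (fun _ => rfl) fun v => by
        simp only [LinearMap.comp_apply, hg, hτ]
    have h₁ : χ ((1 : A') • w) = χ ((1 : A') • h (g w)) :=
      DFunLike.congr_fun (LinearMap.congr_fun hφ w) 1
    rw [one_smul, one_smul] at h₁
    rw [map_sub, sub_eq_zero]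
    exact h₁
  let e : P ≃ₗ[A'] W := LinearEquiv.ofLinearMap h g hhg hgh
  refine ⟨?_, P, _, _, hfin, hproj, ⟨e⟩⟩
  have hr : Set.range τ = h '' Set.range τ₀ := by
    rw [← Set.range_comp]
    exact congrArg Set.range (funext fun v => (hτ v).symm)
  rw [hr, ← Submodule.map_span, hspan, Submodule.map_top]
  exact LinearMap.range_eq_top.mpr e.surjective

/-- Let `ν : A → A'` be a ring homomorphism, `V` a finitely generated
projective `A`-module, and `σ : V[F_μ] → V[F_μ]` an `A[F_μ]`-linear map with `ε(σ)` an
isomorphism. Let `(W, τ)` be the base change `A' ⊗_A V` (expressed by its universal property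
among `ν`-semilinear maps) and let `σ'` be the induced map `1⊗σ` on
`(A' ⊗_A V)[F_μ] ≅ A'[F_μ] ⊗_{A[F_μ]} V[F_μ]`. Then `σ'` is injective, its augmentation is
`1 ⊗ ε(σ)` (an isomorphism), and `coker σ' = A'[F_μ] ⊗_{A[F_μ]} coker σ` lies in `Flk(A')`.
Hence `A'[F_μ] ⊗_{A[F_μ]} -` carries `Flk(A)` into `Flk(A')`. -/
theorem statement4 (μ : ℕ) (A : Type u) [Ring A] (A' : Type u') [Ring A'] (ν : A →+* A')
    (V : Type*) [AddCommGroup V] [Module A V] [Module.Finite A V] [Module.Projective A V]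
    (σ : (FG μ →₀ V) →ₗ[GR μ A] (FG μ →₀ V))
    (hσ : Function.Bijective (augMap μ A σ))
    (W : Type*) [AddCommGroup W] [Module A' W] (τ : V →ₛₗ[ν] W)
    (hW : ∀ (U : Type u') [AddCommGroup U] [Module A' U] (f : V →ₛₗ[ν] U),
      ∃! g : W →ₗ[A'] U, ∀ v, g (τ v) = f v)
    (σ' : (FG μ →₀ W) →ₗ[GR μ A'] (FG μ →₀ W))
    (hσ' : ∀ (g : FG μ) (v : V),
      σ' (Finsupp.single g (τ v)) = Finsupp.mapDomain (fun h => g * h)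
        (Finsupp.mapRange τ (map_zero τ) (σ (Finsupp.single 1 v)))) :
    Function.Injective σ' ∧
    (∀ v : V, augMap μ A' σ' (τ v) = τ (augMap μ A σ v)) ∧
    Function.Bijective (augMap μ A' σ') ∧
    IsFlk μ A' ((FG μ →₀ W) ⧸ LinearMap.range σ') := by
  obtain ⟨hspan, P, _, _, _, _, ⟨e⟩⟩ := exists_small_baseChange ν τ hW
  have haug : ∀ v : V, augMap μ A' σ' (τ v) = τ (augMap μ A σ v) := by
    intro v
    rw [augMap_eq_augSum, hσ', augMap_eq_augSum]
    exact (augSum_shiftEnd 1 _).trans (augSum_mapRange τ.toAddMonoidHom _)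
  let α : V ≃ₗ[A] V := LinearEquiv.ofBijective (augLinearMap σ) hσ
  obtain ⟨b, hb, -⟩ := hW P
    ((e.symm.toLinearMap.comp τ).comp α.symm.toLinearMap)
  let β : W →ₗ[A'] W := e.toLinearMap ∘ₗ b
  have hβ : ∀ v, β (τ v) = τ (α.symm v) := fun v => by simp [β, hb]
  have h₁ : β ∘ₗ augLinearMap σ' = LinearMap.id :=
    LinearMap.ext_on_range hspan fun v => by
      refine (congrArg β (haug v)).trans ((hβ _).trans (congrArg τ ?_))
      exact α.symm_apply_apply v
  have h₂ : augLinearMap σ' ∘ₗ β = LinearMap.id :=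
    LinearMap.ext_on_range hspan fun v => by
      refine (congrArg (augMap μ A' σ') (hβ v)).trans ((haug _).trans (congrArg τ ?_))
      exact α.apply_symm_apply v
  have hbij : Function.Bijective (augMap μ A' σ') :=
    Function.bijective_iff_has_inverse.mpr ⟨β, LinearMap.congr_fun h₁, LinearMap.congr_fun h₂⟩
  exact ⟨injective_of_augMap_injective σ' hbij.injective, haug, hbij,
    isFlk_quotient_range P e σ' hbij⟩
end
end

section
/- Let k be a field and M ∈ Flk(k). Then M satisfies both chain conditions relative to Flk(k): every ascending chain N_1 ⊆ N_2 ⊆ ⋯ of k[F_μ]-submodules of M with each N_i ∈ Flk(k) is eventually constant, and every descending chain of such submodules is eventually constant. Consequently M admits a finite filtration 0 = M_0 ⊂ M_1 ⊂ ⋯ ⊂ M_s = M with each M_i ∈ Flk(k) and each quotient M_i/M_{i−1} simple in Flk(k) (nonzero, with no k[F_μ]-submodules belonging to Flk(k) other than 0 and itself). -/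
open Finsupp

noncomputable section

/-- The augmentation `ε(σ) : A^n → A^n` of an `A[F_μ]`-linear endomorphism `σ` of
`(A[F_μ])^n`. -/
def augPi (μ : ℕ) (A : Type*) [Ring A] {n : ℕ}
    (σ : (Fin n → GR μ A) →ₗ[GR μ A] (Fin n → GR μ A)) : (Fin n → A) → (Fin n → A) :=
  fun v j => aug μ A (σ (fun i => MonoidAlgebra.single 1 (v i)) j)

/-- `M` is an `F_μ`-link module over the field `k` (`M ∈ Flk(k)`): there are `n ≥ 0` and an
exact sequence `0 → (k[F_μ])^n →^σ (k[F_μ])^n → M → 0` with `ε(σ) : k^n → k^n` invertible. -/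
def IsFlkField (μ : ℕ) (k : Type*) [Field k] (M : Type*) [AddCommGroup M]
    [Module (GR μ k) M] : Prop :=
  ∃ (n : ℕ) (σ : (Fin n → GR μ k) →ₗ[GR μ k] (Fin n → GR μ k))
    (p : (Fin n → GR μ k) →ₗ[GR μ k] M),
      Function.Injective σ ∧ Function.Surjective p ∧ LinearMap.range σ = LinearMap.ker p ∧
      Function.Bijective (augPi μ k σ)



section FoxInverse

variable {k R M ι : Type*} [Field k] [Ring R] [AddCommGroup M] [Module R M] [Module k M]
  [Fintype ι]

/-- The operators `δᵢ` form the inverse of the map `(yᵢ) ↦ ∑ᵢ (zᵢ - 1) yᵢ`. -/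
structure IsFoxInverse (z : ι → Rˣ) (δ : ι → M →ₗ[k] M) : Prop where
  sum_smul : ∀ m, ∑ i, ((z i : R) - 1) • δ i m = m
  apply_sum : ∀ (y : ι → M) j, δ j (∑ i, ((z i : R) - 1) • y i) = y j

namespace IsFoxInverse

variable {z : ι → Rˣ} {δ : ι → M →ₗ[k] M}

theorem apply_sub_one_smul [DecidableEq ι] (h : IsFoxInverse z δ) (i j : ι) (v : M) :
    δ j (((z i : R) - 1) • v) = Pi.single (M := fun _ => M) i v j := by
  rw [← h.apply_sum (Pi.single i v) j]
  congr 1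
  rw [Finset.sum_eq_single i] <;> simp +contextual

theorem apply_smul [DecidableEq ι] (h : IsFoxInverse z δ) (i j : ι) (v : M) :
    δ j ((z i : R) • v) = δ j v + Pi.single (M := fun _ => M) i v j := by
  rw [← h.apply_sub_one_smul, ← map_add, sub_smul, one_smul, add_sub_cancel]

theorem apply_inv_smul [DecidableEq ι] (h : IsFoxInverse z δ) (i j : ι) (v : M) :
    δ j (((z i)⁻¹ : Rˣ).val • v) =
      δ j v - Pi.single (M := fun _ => M) i (((z i)⁻¹ : Rˣ).val • v) j := by
  rw [← h.apply_sub_one_smul, ← map_sub, sub_smul, one_smul, smul_smul, Units.mul_inv, one_smul,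
    sub_sub_cancel]

end IsFoxInverse

end FoxInverse

section Lattice

variable {k R M ι : Type*} [Field k] [Ring R] [Algebra k R] [AddCommGroup M] [Module R M]
  [Module k M] [IsScalarTower k R M]

/-- The `k`-subspace `W + ∑ᵢ zᵢ W + ∑ᵢ zᵢ⁻¹ W`. -/
def enlarge (z : ι → Rˣ) (W : Submodule k M) : Submodule k M :=
  W ⊔ (⨆ i, W.map (Algebra.lsmul k k M (z i : R))) ⊔
    ⨆ i, W.map (Algebra.lsmul k k M ((z i)⁻¹ : Rˣ).val)

theorem le_enlarge (z : ι → Rˣ) (W : Submodule k M) : W ≤ enlarge z W :=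
  le_sup_left.trans le_sup_left

theorem smul_mem_enlarge (z : ι → Rˣ) {W : Submodule k M} {x : M} (hx : x ∈ W) (i : ι) :
    (z i : R) • x ∈ enlarge z W :=
  (le_sup_right.trans le_sup_left : _ ≤ enlarge z W)
    ((le_iSup (fun i => W.map (Algebra.lsmul k k M (z i : R))) i) ⟨x, hx, rfl⟩)

theorem inv_smul_mem_enlarge (z : ι → Rˣ) {W : Submodule k M} {x : M} (hx : x ∈ W) (i : ι) :
    ((z i)⁻¹ : Rˣ).val • x ∈ enlarge z W :=
  (le_sup_right : _ ≤ enlarge z W)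
    ((le_iSup (fun i => W.map (Algebra.lsmul k k M ((z i)⁻¹ : Rˣ).val)) i) ⟨x, hx, rfl⟩)

theorem enlarge_le {z : ι → Rˣ} {W Q : Submodule k M} (h : W ≤ Q)
    (hz : ∀ i, ∀ x ∈ W, (z i : R) • x ∈ Q) (hz' : ∀ i, ∀ x ∈ W, ((z i)⁻¹ : Rˣ).val • x ∈ Q) :
    enlarge z W ≤ Q := by
  refine sup_le (sup_le h (iSup_le fun i => ?_)) (iSup_le fun i => ?_)
  · rintro _ ⟨x, hx, rfl⟩
    exact hz i x hx
  · rintro _ ⟨x, hx, rfl⟩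
    exact hz' i x hx

theorem iterate_enlarge_mono (z : ι → Rˣ) (W : Submodule k M) :
    Monotone fun n => (enlarge z)^[n] W :=
  monotone_nat_of_le_succ fun n => by
    rw [Function.iterate_succ_apply']
    exact le_enlarge z _

theorem exists_mem_iterate_enlarge {z : ι → Rˣ}
    (hgen : Algebra.adjoin k (Set.range (fun i => (z i : R)) ∪
      Set.range (fun i => ((z i)⁻¹ : Rˣ).val)) = ⊤)
    (W : Submodule k M) {x : M} (hx : x ∈ Submodule.span R (W : Set M)) :
    ∃ n, x ∈ (enlarge z)^[n] W := by
  have hmono := iterate_enlarge_mono z W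
  have hsmul : ∀ r : R, ∀ n, ∀ x ∈ (enlarge z)^[n] W, ∃ m, r • x ∈ (enlarge z)^[m] W := by
    intro r
    have hr : r ∈ Algebra.adjoin k (Set.range (fun i => (z i : R)) ∪
      Set.range (fun i => ((z i)⁻¹ : Rˣ).val)) := hgen ▸ Algebra.mem_top
    induction hr using Algebra.adjoin_induction with
    | mem r hr =>
      intro n x hx
      refine ⟨n + 1, ?_⟩
      rw [Function.iterate_succ_apply']
      rcases hr with ⟨i, rfl⟩ | ⟨i, rfl⟩
      · exact smul_mem_enlarge z hx i
      · exact inv_smul_mem_enlarge z hx i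
    | algebraMap c =>
      intro n x hx
      exact ⟨n, by rw [algebraMap_smul]; exact Submodule.smul_mem _ c hx⟩
    | add r s _ _ ihr ihs =>
      intro n x hx
      obtain ⟨a, ha⟩ := ihr n x hx
      obtain ⟨b, hb⟩ := ihs n x hx
      refine ⟨max a b, ?_⟩
      rw [add_smul]
      exact add_mem (hmono (le_max_left a b) ha) (hmono (le_max_right a b) hb)
    | mul r s _ _ ihr ihs =>
      intro n x hx
      obtain ⟨a, ha⟩ := ihs n x hx
      obtain ⟨b, hb⟩ := ihr a _ ha
      exact ⟨b, by rwa [mul_smul]⟩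
  induction hx using Submodule.span_induction with
  | mem x hx => exact ⟨0, hx⟩
  | zero => exact ⟨0, zero_mem _⟩
  | add x y _ _ ihx ihy =>
    obtain ⟨a, ha⟩ := ihx
    obtain ⟨b, hb⟩ := ihy
    exact ⟨max a b, add_mem (hmono (le_max_left a b) ha) (hmono (le_max_right a b) hb)⟩
  | smul r x _ ih =>
    obtain ⟨a, ha⟩ := ih
    exact hsmul r a x ha

variable [Fintype ι]

theorem enlarge_fg (z : ι → Rˣ) {W : Submodule k M} (h : W.FG) : (enlarge z W).FG :=
  (h.sup (Submodule.fg_iSup _ fun _ => h.map _)).sup (Submodule.fg_iSup _ fun _ => h.map _)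

theorem exists_isFoxInverse {z : ι → Rˣ}
    (hbij : Function.Bijective fun y : ι → M => ∑ i, ((z i : R) - 1) • y i) :
    ∃ δ : ι → M →ₗ[k] M, IsFoxInverse z δ := by
  let θ : (ι → M) →ₗ[k] M :=
    ∑ i, (Algebra.lsmul k k M ((z i : R) - 1)) ∘ₗ LinearMap.proj i
  have hθ : ∀ y, θ y = ∑ i, ((z i : R) - 1) • y i := fun y => by
    simp only [θ, LinearMap.sum_apply, LinearMap.comp_apply, LinearMap.proj_apply,
      Algebra.lsmul_coe]
  have hb : Function.Bijective θ := by rwa [funext hθ]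
  let e := LinearEquiv.ofBijective θ hb
  refine ⟨fun i => LinearMap.proj i ∘ₗ e.symm.toLinearMap, fun m => ?_, fun y j => ?_⟩
  · exact (hθ (e.symm m)).symm.trans (e.apply_symm_apply m)
  · rw [← hθ]
    exact congrFun (e.symm_apply_apply y) j

namespace IsFoxInverse

variable {z : ι → Rˣ} {δ : ι → M →ₗ[k] M}

theorem enlarge_le_comap (h : IsFoxInverse z δ) {W : Submodule k M}
    (hW : ∀ j, W ≤ W.comap (δ j)) (j : ι) :
    enlarge z W ≤ (W ⊔ W.map (Algebra.lsmul k k M ((z j)⁻¹ : Rˣ).val)).comap (δ j) := by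
  classical
  refine enlarge_le (fun x hx => ?_) (fun i x hx => ?_) (fun i x hx => ?_) <;>
    rw [Submodule.mem_comap]
  · exact Submodule.mem_sup_left (hW j hx)
  · rw [h.apply_smul]
    refine Submodule.mem_sup_left (add_mem (hW j hx) ?_)
    by_cases hij : j = i <;> simp [hij, hx]
  · rw [h.apply_inv_smul]
    refine sub_mem (Submodule.mem_sup_left (hW j hx)) ?_
    by_cases hij : j = i
    · subst hij
      rw [Pi.single_eq_same]
      exact Submodule.mem_sup_right ⟨x, hx, rfl⟩
    · simp [hij]

theorem enlarge_le_comap_enlarge (h : IsFoxInverse z δ) {W : Submodule k M}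
    (hW : ∀ j, W ≤ W.comap (δ j)) (j : ι) :
    enlarge z W ≤ (enlarge z W).comap (δ j) :=
  (h.enlarge_le_comap hW j).trans <| Submodule.comap_mono <| sup_le (le_enlarge z W) <| by
    rintro _ ⟨x, hx, rfl⟩
    exact inv_smul_mem_enlarge z hx j

theorem iterate_enlarge_le_comap (h : IsFoxInverse z δ) {W : Submodule k M}
    (hW : ∀ j, W ≤ W.comap (δ j)) (n : ℕ) (j : ι) :
    (enlarge z)^[n] W ≤ ((enlarge z)^[n] W).comap (δ j) := by
  induction n generalizing j with
  | zero => exact hW j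
  | succ n ih =>
    rw [Function.iterate_succ_apply']
    exact h.enlarge_le_comap_enlarge ih j

theorem mem_span_of_mem_enlarge (h : IsFoxInverse z δ) {W : Submodule k M}
    (hW : ∀ j, W ≤ W.comap (δ j)) {N : Submodule R M} (hN : ∀ j, ∀ x ∈ N, δ j x ∈ N) {x : M}
    (hxN : x ∈ N) (hx : x ∈ enlarge z W) : x ∈ Submodule.span R ((N : Set M) ∩ W) := by
  classical
  set S := Submodule.span R ((N : Set M) ∩ W)
  rw [← h.sum_smul x]
  refine Submodule.sum_mem _ fun j _ => S.smul_mem _ ?_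
  obtain ⟨c, hc, _, ⟨b, hb, rfl⟩, hcb⟩ :=
    Submodule.mem_sup.mp (Submodule.mem_comap.mp (h.enlarge_le_comap hW j hx))
  rw [Algebra.lsmul_coe] at hcb
  have hNj : δ j x ∈ N := hN j x hxN
  have hδδ : ∀ i, δ i (δ j x) =
      δ i c + δ i b - Pi.single (M := fun _ => M) j (((z j)⁻¹ : Rˣ).val • b) i := fun i => by
    rw [← hcb, map_add, h.apply_inv_smul, add_sub_assoc]
  have hne : ∀ i, i ≠ j → δ i (δ j x) ∈ S := fun i hij => by
    refine Submodule.subset_span ⟨hN i _ hNj, ?_⟩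
    rw [hδδ, Pi.single_eq_of_ne hij, sub_zero]
    exact add_mem (hW i hc) (hW i hb)
  have hadd : δ j (δ j x) + δ j x ∈ S := by
    refine Submodule.subset_span ⟨add_mem (hN j _ hNj) hNj, ?_⟩
    rw [hδδ, Pi.single_eq_same, ← hcb]
    have : δ j c + δ j b - ((z j)⁻¹ : Rˣ).val • b + (c + ((z j)⁻¹ : Rˣ).val • b) =
        δ j c + δ j b + c := by abel
    rw [this]
    exact add_mem (add_mem (hW j hc) (hW j hb)) hc
  have hsub : δ j x - ((z j : R) - 1) • δ j (δ j x) ∈ S := by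
    have hsum := h.sum_smul (δ j x)
    rw [← Finset.add_sum_erase _ _ (Finset.mem_univ j)] at hsum
    rw [← eq_sub_of_add_eq' hsum]
    exact Submodule.sum_mem _ fun i hi => S.smul_mem _ (hne i (Finset.ne_of_mem_erase hi))
  have hz : (z j : R) • δ j (δ j x) ∈ S := by
    convert sub_mem hadd hsub using 1
    rw [sub_smul, one_smul]
    abel
  have hq : δ j (δ j x) ∈ S := by
    have := S.smul_mem ((z j)⁻¹ : Rˣ).val hz
    rwa [smul_smul, Units.inv_mul, one_smul] at this
  exact (S.add_mem_iff_right hq).mp hadd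

theorem mem_span_of_mem_iterate_enlarge (h : IsFoxInverse z δ) {W : Submodule k M}
    (hW : ∀ j, W ≤ W.comap (δ j)) {N : Submodule R M} (hN : ∀ j, ∀ x ∈ N, δ j x ∈ N) (n : ℕ)
    {x : M} (hxN : x ∈ N) (hx : x ∈ (enlarge z)^[n] W) :
    x ∈ Submodule.span R ((N : Set M) ∩ W) := by
  induction n generalizing x with
  | zero => exact Submodule.subset_span ⟨hxN, hx⟩
  | succ n ih =>
    rw [Function.iterate_succ_apply'] at hx
    refine Submodule.span_le.mpr ?_
      (h.mem_span_of_mem_enlarge (h.iterate_enlarge_le_comap hW n) hN hxN hx)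
    exact fun y hy => ih hy.1 hy.2

theorem exists_lattice (h : IsFoxInverse z δ) [Module.Finite R M]
    (hgen : Algebra.adjoin k (Set.range (fun i => (z i : R)) ∪
      Set.range (fun i => ((z i)⁻¹ : Rˣ).val)) = ⊤) :
    ∃ V : Submodule k M, V.FG ∧ (∀ j, V ≤ V.comap (δ j)) ∧
      Submodule.span R (V : Set M) = ⊤ := by
  classical
  obtain ⟨s, hs⟩ := Module.Finite.fg_top (R := R) (M := M)
  let W : Submodule k M := Submodule.span k (s : Set M)
  have hWtop : Submodule.span R (W : Set M) = ⊤ :=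
    top_unique (hs ▸ Submodule.span_mono Submodule.subset_span)
  have hex : ∀ x : M, ∃ n, x ∈ (enlarge z)^[n] W := fun x =>
    exists_mem_iterate_enlarge hgen W (hWtop ▸ Submodule.mem_top)
  choose f hf using hex
  have hmono := iterate_enlarge_mono z W
  let n := s.sup fun x => Finset.univ.sup fun j => f (δ j x)
  have hn : ∀ m ≤ n, ∀ j, (enlarge z)^[m] W ≤ ((enlarge z)^[n] W).comap (δ j) := by
    intro m
    induction m with
    | zero =>
      intro _ j
      refine Submodule.span_le.mpr fun x hx => hmono ?_ (hf (δ j x))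
      exact (Finset.le_sup (f := fun j => f (δ j x)) (Finset.mem_univ j)).trans
        (Finset.le_sup (f := fun x => Finset.univ.sup fun j => f (δ j x)) hx)
    | succ m ih =>
      intro hm j
      have ih := ih (by omega) j
      have hle := hmono hm
      simp only [Function.iterate_succ_apply'] at hle ⊢
      refine enlarge_le ih (fun i x hx => ?_) (fun i x hx => ?_) <;> rw [Submodule.mem_comap]
      · rw [h.apply_smul]
        refine add_mem (ih hx) ?_
        by_cases hij : j = i
        · subst hij
          rw [Pi.single_eq_same]
          exact hle (le_enlarge z _ hx)
        · simp [hij]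
      · rw [h.apply_inv_smul]
        refine sub_mem (ih hx) ?_
        by_cases hij : j = i
        · subst hij
          rw [Pi.single_eq_same]
          exact hle (inv_smul_mem_enlarge z hx j)
        · simp [hij]
  refine ⟨(enlarge z)^[n] W, ?_, hn n le_rfl, top_unique ?_⟩
  · generalize n = m
    induction m with
    | zero => exact ⟨s, rfl⟩
    | succ m ih =>
      rw [Function.iterate_succ_apply']
      exact enlarge_fg z ih
  · rw [← hWtop]
    exact Submodule.span_mono (hmono (Nat.zero_le n))

/-- A finitely generated module on which `(yᵢ) ↦ ∑ᵢ (zᵢ - 1) yᵢ` is invertible contains a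
finite-dimensional subspace whose intersection with any `δ`-stable submodule generates it. -/
theorem exists_fg_detecting (h : IsFoxInverse z δ) [Module.Finite R M]
    (hgen : Algebra.adjoin k (Set.range (fun i => (z i : R)) ∪
      Set.range (fun i => ((z i)⁻¹ : Rˣ).val)) = ⊤) :
    ∃ V : Submodule k M, V.FG ∧ ∀ N : Submodule R M, (∀ j, ∀ x ∈ N, δ j x ∈ N) →
      N ≤ Submodule.span R ((N : Set M) ∩ V) := by
  obtain ⟨V, hfg, hV, htop⟩ := h.exists_lattice hgen
  refine ⟨V, hfg, fun N hN x hx => ?_⟩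
  obtain ⟨n, hn⟩ := exists_mem_iterate_enlarge hgen V (x := x) (htop ▸ Submodule.mem_top)
  exact h.mem_span_of_mem_iterate_enlarge hV hN n hx hn

end IsFoxInverse

end Lattice

section FreeGroupRing

variable {μ : ℕ} {k : Type*} [Field k]

/-- The generator `zᵢ` of `F_μ` as a unit of the group ring. -/
def gen (μ : ℕ) (k : Type*) [Field k] (i : Fin μ) : (GR μ k)ˣ :=
  Units.map (MonoidAlgebra.of k (FG μ)) (toUnits (FreeGroup.of i))

theorem val_gen (i : Fin μ) : (gen μ k i : GR μ k) = MonoidAlgebra.of k (FG μ) (FreeGroup.of i) :=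
  rfl

theorem val_inv_gen (i : Fin μ) :
    ((gen μ k i)⁻¹ : (GR μ k)ˣ).val = MonoidAlgebra.of k (FG μ) (FreeGroup.of i)⁻¹ :=
  rfl

theorem adjoin_gen :
    Algebra.adjoin k (Set.range (fun i => (gen μ k i : GR μ k)) ∪
      Set.range (fun i => ((gen μ k i)⁻¹ : (GR μ k)ˣ).val)) = ⊤ := by
  refine top_unique fun r _ => ?_
  induction r using MonoidAlgebra.induction_on with
  | of g =>
    induction g using FreeGroup.induction_on with
    | C1 => rw [map_one]; exact one_mem _
    | of i => exact Algebra.subset_adjoin (Or.inl ⟨i, rfl⟩)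
    | inv_of i _ => exact Algebra.subset_adjoin (Or.inr ⟨i, rfl⟩)
    | mul g h hg hh => rw [map_mul]; exact mul_mem (hg trivial) (hh trivial)
  | add a b ha hb => exact add_mem (ha trivial) (hb trivial)
  | smul c a ha => exact Subalgebra.smul_mem _ (ha trivial) c

theorem aug_single (g : FG μ) (a : k) : aug μ k (MonoidAlgebra.single g a) = a := by
  simp [aug]

theorem aug_of (g : FG μ) : aug μ k (MonoidAlgebra.of k (FG μ) g) = 1 := by
  simp [aug_single]

theorem aug_gen_sub_one (i : Fin μ) : aug μ k ((gen μ k i : GR μ k) - 1) = 0 := by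
  rw [map_sub, map_one, val_gen, aug_of, sub_self]

theorem exists_sub_aug_eq_sum (r : GR μ k) :
    ∃ y : Fin μ → GR μ k,
      r - MonoidAlgebra.single 1 (aug μ k r) = ∑ i, ((gen μ k i : GR μ k) - 1) * y i := by
  induction r using MonoidAlgebra.induction_on with
  | of g =>
    rw [aug_of, ← MonoidAlgebra.one_def]
    induction g using FreeGroup.induction_on with
    | C1 => exact ⟨0, by rw [map_one]; simp⟩
    | of i =>
      refine ⟨Pi.single i 1, ?_⟩
      rw [Finset.sum_eq_single i] <;> simp +contextual [val_gen]
    | inv_of i _ =>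
      refine ⟨Pi.single i (-((gen μ k i)⁻¹ : (GR μ k)ˣ).val), ?_⟩
      rw [← val_inv_gen, Finset.sum_eq_single i, Pi.single_eq_same, mul_neg, sub_mul,
        Units.mul_inv, one_mul, neg_sub] <;> simp +contextual
    | mul g h hg hh =>
      obtain ⟨y, hy⟩ := hg
      obtain ⟨w, hw⟩ := hh
      refine ⟨fun i => y i * MonoidAlgebra.of k (FG μ) h + w i, ?_⟩
      simp only [mul_add, Finset.sum_add_distrib, ← mul_assoc, ← Finset.sum_mul]
      rw [← hy, ← hw, map_mul, sub_mul, one_mul, sub_add_sub_cancel]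
  | add a b ha hb =>
    obtain ⟨y, hy⟩ := ha
    obtain ⟨w, hw⟩ := hb
    refine ⟨y + w, ?_⟩
    simp only [Pi.add_apply, mul_add, Finset.sum_add_distrib]
    rw [← hy, ← hw, map_add, MonoidAlgebra.single_add, add_sub_add_comm]
  | smul c a ha =>
    obtain ⟨y, hy⟩ := ha
    refine ⟨c • y, ?_⟩
    have hc : aug μ k (c • a) = c * aug μ k a := by
      rw [← one_mul a, ← smul_mul_assoc, map_mul, one_mul, MonoidAlgebra.one_def,
        MonoidAlgebra.smul_single, aug_single, smul_eq_mul, mul_one]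
    simp only [Pi.smul_apply, mul_smul_comm, ← Finset.smul_sum]
    rw [← hy, hc, smul_sub, MonoidAlgebra.smul_single, smul_eq_mul]

/-- The representation `g ↦ !![1, ∂ⱼg; 0, g]`, where `∂ⱼ` is the Fox derivative. -/
def foxMatrix (μ : ℕ) (k : Type*) [Field k] (j : Fin μ) :
    GR μ k →ₐ[k] Matrix (Fin 2) (Fin 2) (GR μ k) :=
  MonoidAlgebra.lift k _ (FG μ) <|
    (Units.coeHom (Matrix (Fin 2) (Fin 2) (GR μ k))).comp <| FreeGroup.lift fun i =>
    { val := !![1, Pi.single (M := fun _ => GR μ k) i 1 j; 0, (gen μ k i : GR μ k)]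
      inv := !![1, -(Pi.single (M := fun _ => GR μ k) i 1 j * ((gen μ k i)⁻¹ : (GR μ k)ˣ).val);
        0, ((gen μ k i)⁻¹ : (GR μ k)ˣ).val]
      val_inv := by
        ext a b; fin_cases a <;> fin_cases b <;> simp [Matrix.mul_apply, Fin.sum_univ_two]
      inv_val := by
        ext a b; fin_cases a <;> fin_cases b <;>
          simp [Matrix.mul_apply, Fin.sum_univ_two, mul_assoc] }

theorem foxMatrix_gen (i j : Fin μ) :
    foxMatrix μ k j (gen μ k i : GR μ k) =
      !![1, Pi.single (M := fun _ => GR μ k) i 1 j; 0, (gen μ k i : GR μ k)] := by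
  rw [val_gen, foxMatrix, MonoidAlgebra.lift_of]
  simp [val_gen]

theorem foxMatrix_inv_gen (i j : Fin μ) :
    foxMatrix μ k j ((gen μ k i)⁻¹ : (GR μ k)ˣ).val =
      !![1, -(Pi.single (M := fun _ => GR μ k) i 1 j * ((gen μ k i)⁻¹ : (GR μ k)ˣ).val);
        0, ((gen μ k i)⁻¹ : (GR μ k)ˣ).val] := by
  rw [val_inv_gen, foxMatrix, MonoidAlgebra.lift_of]
  simp only [MonoidHom.comp_apply, map_inv, FreeGroup.lift_apply_of, Units.coeHom_apply]
  rfl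

theorem foxMatrix_row_one (j : Fin μ) (r : GR μ k) :
    foxMatrix μ k j r 1 0 = 0 ∧ foxMatrix μ k j r 1 1 = r := by
  have hr : r ∈ Algebra.adjoin k (Set.range (fun i => (gen μ k i : GR μ k)) ∪
      Set.range (fun i => ((gen μ k i)⁻¹ : (GR μ k)ˣ).val)) := by
    rw [adjoin_gen]
    exact Algebra.mem_top
  induction hr using Algebra.adjoin_induction with
  | mem r hr =>
    rcases hr with ⟨i, rfl⟩ | ⟨i, rfl⟩
    · simp [foxMatrix_gen]
    · simp [foxMatrix_inv_gen]
  | algebraMap c => rw [AlgHom.commutes]; simp [Matrix.algebraMap_matrix_apply]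
  | add r s _ _ ihr ihs => simp [ihr, ihs]
  | mul r s _ _ ihr ihs => simp [Matrix.mul_apply, ihr, ihs]

theorem foxMatrix_sum (j : Fin μ) (y : Fin μ → GR μ k) :
    foxMatrix μ k j (∑ i, ((gen μ k i : GR μ k) - 1) * y i) 0 1 = y j := by
  rw [map_sum, Matrix.sum_apply, Finset.sum_eq_single j]
  · simp [Matrix.mul_apply, foxMatrix_gen, foxMatrix_row_one]
  · intro i _ hij
    simp [Matrix.mul_apply, foxMatrix_gen, Pi.single_eq_of_ne' hij]
  · simp

end FreeGroupRing

section LinkModule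

variable {μ : ℕ} {k : Type*} [Field k]

theorem aug_map_apply {m n : ℕ} (σ : (Fin m → GR μ k) →ₗ[GR μ k] (Fin n → GR μ k))
    (x : Fin m → GR μ k) (j : Fin n) :
    aug μ k (σ x j) = ∑ i, aug μ k (x i) * aug μ k (σ (Pi.single i 1) j) := by
  conv_lhs => rw [← Finset.univ_sum_single x, map_sum, Finset.sum_apply, map_sum]
  refine Finset.sum_congr rfl fun i _ => ?_
  rw [← map_mul, ← smul_eq_mul (x i), ← Pi.smul_apply, ← map_smul, ← Pi.single_smul, smul_eq_mul,
    mul_one]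

theorem aug_map_apply_eq_zero {m n : ℕ} (σ : (Fin m → GR μ k) →ₗ[GR μ k] (Fin n → GR μ k))
    {x : Fin m → GR μ k} (hx : ∀ i, aug μ k (x i) = 0) (j : Fin n) : aug μ k (σ x j) = 0 := by
  rw [aug_map_apply]
  simp [hx]

theorem augPi_aug {n : ℕ} (σ : (Fin n → GR μ k) →ₗ[GR μ k] (Fin n → GR μ k))
    (x : Fin n → GR μ k) (j : Fin n) :
    augPi μ k σ (fun i => aug μ k (x i)) j = aug μ k (σ x j) := by
  rw [augPi, aug_map_apply, aug_map_apply]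
  simp only [aug_single]

theorem augPi_bijective_iff {n : ℕ} (σ : (Fin n → GR μ k) →ₗ[GR μ k] (Fin n → GR μ k)) :
    Function.Bijective (augPi μ k σ) ↔
      (∀ x, (∀ j, aug μ k (σ x j) = 0) → ∀ j, aug μ k (x j) = 0) ∧
        ∀ y : Fin n → GR μ k, ∃ x, ∀ j, aug μ k ((y - σ x) j) = 0 := by
  have hlift : ∀ v : Fin n → k, ∃ x : Fin n → GR μ k, (fun j => aug μ k (x j)) = v := fun v =>
    ⟨fun j => MonoidAlgebra.single 1 (v j), by simp [aug_single]⟩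
  refine ⟨fun ⟨hinj, hsurj⟩ => ⟨fun x hx => ?_, fun y => ?_⟩, fun ⟨hinj, hsurj⟩ => ⟨?_, ?_⟩⟩
  · refine congrFun (hinj (a₁ := fun j => aug μ k (x j)) (a₂ := fun _ => 0) (funext fun j => ?_))
    have h0 := augPi_aug σ 0 j
    simp only [Pi.zero_apply, map_zero] at h0
    rw [augPi_aug, hx, h0]
  · obtain ⟨v, hv⟩ := hsurj fun j => aug μ k (y j)
    obtain ⟨x, rfl⟩ := hlift v
    exact ⟨x, fun j => by rw [Pi.sub_apply, map_sub, ← augPi_aug, hv, sub_self]⟩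
  · intro v w hvw
    obtain ⟨x, rfl⟩ := hlift v
    obtain ⟨y, rfl⟩ := hlift w
    have := hinj (x - y) fun j => by
      rw [map_sub, Pi.sub_apply, map_sub, ← augPi_aug, ← augPi_aug, hvw, sub_self]
    simpa [sub_eq_zero, funext_iff] using this
  · intro v
    obtain ⟨y, rfl⟩ := hlift v
    obtain ⟨x, hx⟩ := hsurj y
    refine ⟨fun j => aug μ k (x j), funext fun j => ?_⟩
    have := hx j
    rw [Pi.sub_apply, map_sub, sub_eq_zero] at this
    rw [augPi_aug, this]

theorem exists_splitting (μ : ℕ) (k : Type*) [Field k] (m n : ℕ) :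
    ∃ e : (Fin (m + n) → GR μ k) ≃ₗ[GR μ k] (Fin m → GR μ k) × (Fin n → GR μ k), ∀ x,
      ((∀ j, aug μ k ((e x).1 j) = 0) ∧ ∀ j, aug μ k ((e x).2 j) = 0) ↔
        ∀ j, aug μ k (x j) = 0 := by
  refine ⟨LinearEquiv.funCongrLeft _ _ finSumFinEquiv ≪≫ₗ
    LinearEquiv.sumArrowLequivProdArrow _ _ _ _, fun x => ?_⟩
  rw [← finSumFinEquiv.forall_congr_right (q := fun j => aug μ k (x j) = 0), Sum.forall]
  rfl

theorem exists_eq_sum_of_aug_eq_zero {n : ℕ} {x : Fin n → GR μ k}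
    (hx : ∀ j, aug μ k (x j) = 0) :
    ∃ y : Fin μ → Fin n → GR μ k, x = ∑ i, ((gen μ k i : GR μ k) - 1) • y i := by
  choose y hy using fun j => exists_sub_aug_eq_sum (x j)
  refine ⟨fun i j => y j i, funext fun j => ?_⟩
  have := hy j
  rw [hx, MonoidAlgebra.single_zero, sub_zero] at this
  rw [this]
  simp

theorem sum_sub_one_smul_injective {n : ℕ} :
    Function.Injective fun y : Fin μ → Fin n → GR μ k =>
      ∑ i, ((gen μ k i : GR μ k) - 1) • y i := by
  intro y w h
  funext i j
  rw [← foxMatrix_sum i fun l => y l j, ← foxMatrix_sum i fun l => w l j]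
  have := congrFun h j
  simp only [Finset.sum_apply, Pi.smul_apply, smul_eq_mul] at this
  rw [this]

namespace IsFlkField

variable {M M' M'' : Type*} [AddCommGroup M] [Module (GR μ k) M] [AddCommGroup M']
  [Module (GR μ k) M'] [AddCommGroup M''] [Module (GR μ k) M'']

theorem finite (hM : IsFlkField μ k M) : Module.Finite (GR μ k) M := by
  obtain ⟨n, σ, p, -, hp, -⟩ := hM
  exact Module.Finite.of_surjective p hp

/-- Sato's condition: the map `(mᵢ) ↦ ∑ᵢ (zᵢ - 1) mᵢ` is bijective on a link module. -/
theorem bijective_sum (hM : IsFlkField μ k M) :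
    Function.Bijective fun y : Fin μ → M => ∑ i, ((gen μ k i : GR μ k) - 1) • y i := by
  obtain ⟨n, σ, p, -, hp, hrange, hbij⟩ := hM
  obtain ⟨hinj, hsurj⟩ := (augPi_bijective_iff σ).mp hbij
  have hpσ : ∀ x, p (σ x) = 0 := fun x => by
    rw [← LinearMap.mem_ker, ← hrange]
    exact ⟨x, rfl⟩
  constructor
  · intro a b hab
    choose x hx using fun i => hp (a i - b i)
    have hker : ∑ i, ((gen μ k i : GR μ k) - 1) • x i ∈ LinearMap.range σ := by
      rw [hrange, LinearMap.mem_ker, map_sum]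
      simp only [map_smul, hx, smul_sub, Finset.sum_sub_distrib]
      exact sub_eq_zero.mpr hab
    obtain ⟨w, hw⟩ := hker
    obtain ⟨y, hy⟩ := exists_eq_sum_of_aug_eq_zero <| hinj w fun j => by
      rw [hw, Finset.sum_apply, map_sum]
      refine Finset.sum_eq_zero fun i _ => ?_
      rw [Pi.smul_apply, smul_eq_mul, map_mul, aug_gen_sub_one, zero_mul]
    have hxy : x = fun i => σ (y i) := sum_sub_one_smul_injective <| by
      simp only [← hw, hy, map_sum, map_smul]
    funext i
    rw [← sub_eq_zero, ← hx, hxy, hpσ]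
  · intro m
    obtain ⟨x, rfl⟩ := hp m
    obtain ⟨w, hw⟩ := hsurj x
    obtain ⟨y, hy⟩ := exists_eq_sum_of_aug_eq_zero hw
    refine ⟨fun i => p (y i), ?_⟩
    simp only [← map_smul, ← map_sum]
    rw [← hy, map_sub, hpσ, sub_zero]

theorem of_equiv (e : M ≃ₗ[GR μ k] M') (hM : IsFlkField μ k M) : IsFlkField μ k M' := by
  obtain ⟨n, σ, p, hσ, hp, hrange, hbij⟩ := hM
  exact ⟨n, σ, e.toLinearMap ∘ₗ p, hσ, e.surjective.comp hp,
    by rw [hrange, LinearEquiv.ker_comp], hbij⟩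

theorem of_subsingleton [Subsingleton M] : IsFlkField μ k M :=
  ⟨0, 0, 0, Function.injective_of_subsingleton _, fun _ => ⟨0, Subsingleton.elim _ _⟩,
    Subsingleton.elim _ _, Function.injective_of_subsingleton _,
    fun v => ⟨v, Subsingleton.elim _ _⟩⟩

/-- Link modules are closed under extensions. -/
theorem of_exact {f : M' →ₗ[GR μ k] M} {g : M →ₗ[GR μ k] M''} (hf : Function.Injective f)
    (hg : Function.Surjective g) (hfg : Function.Exact f g) (hM' : IsFlkField μ k M')
    (hM'' : IsFlkField μ k M'') : IsFlkField μ k M := by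
  obtain ⟨m, σ, p, hσ, hp, hσp, hσbij⟩ := hM'
  obtain ⟨n, τ, q, hτ, hq, hτq, hτbij⟩ := hM''
  have hpσ : ∀ x, p (σ x) = 0 := fun x => by
    rw [← LinearMap.mem_ker, ← hσp]
    exact ⟨x, rfl⟩
  have hqτ : ∀ x, q (τ x) = 0 := fun x => by
    rw [← LinearMap.mem_ker, ← hτq]
    exact ⟨x, rfl⟩
  obtain ⟨q', hq'⟩ := Module.projective_lifting_property g q hg
  replace hq' : ∀ x, g (q' x) = q x := LinearMap.congr_fun hq'
  obtain ⟨ρ, hρ⟩ : ∃ ρ : (Fin n → GR μ k) →ₗ[GR μ k] (Fin m → GR μ k),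
      ∀ x, f (p (ρ x)) = -q' (τ x) := by
    obtain ⟨ρ, hρ⟩ := Module.projective_lifting_property
      ((f ∘ₗ p).codRestrict (LinearMap.ker g) fun x => hfg.apply_apply_eq_zero (p x))
      ((-(q' ∘ₗ τ)).codRestrict (LinearMap.ker g) fun x => by simp [hq', hqτ]) (by
        rintro ⟨y, hy⟩
        obtain ⟨y, rfl⟩ := (hfg y).mp hy
        obtain ⟨x, rfl⟩ := hp y
        exact ⟨x, rfl⟩)
    exact ⟨ρ, fun x => congrArg Subtype.val (LinearMap.congr_fun hρ x)⟩
  obtain ⟨hσ₁, hσ₂⟩ := (augPi_bijective_iff σ).mp hσbij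
  obtain ⟨hτ₁, hτ₂⟩ := (augPi_bijective_iff τ).mp hτbij
  obtain ⟨e, he⟩ := exists_splitting μ k m n
  let T := (σ.coprod ρ).prod (τ ∘ₗ LinearMap.snd (GR μ k) (Fin m → GR μ k) (Fin n → GR μ k))
  have hT : ∀ x y, T (x, y) = (σ x + ρ y, τ y) := fun x y => rfl
  refine ⟨m + n, e.symm.toLinearMap ∘ₗ T ∘ₗ e.toLinearMap, ((f ∘ₗ p).coprod q') ∘ₗ e.toLinearMap,
    ?_, ?_, ?_, (augPi_bijective_iff _).mpr ⟨?_, ?_⟩⟩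
  · refine e.symm.injective.comp (Function.Injective.comp (g := T) ?_ e.injective)
    rw [← LinearMap.ker_eq_bot, LinearMap.ker_eq_bot']
    rintro ⟨x, y⟩ hxy
    rw [hT, Prod.mk_eq_zero] at hxy
    have hy : y = 0 := hτ (by rw [hxy.2, map_zero])
    subst hy
    rw [map_zero, add_zero] at hxy
    rw [hσ (hxy.1.trans (map_zero σ).symm), Prod.mk_zero_zero]
  · refine Function.Surjective.comp (g := (f ∘ₗ p).coprod q') (fun a => ?_) e.surjective
    obtain ⟨y, hy⟩ := hq (g a)
    obtain ⟨b, hb⟩ := (hfg (a - q' y)).mp (by rw [map_sub, hq', hy, sub_self])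
    obtain ⟨x, rfl⟩ := hp b
    exact ⟨(x, y), by simp [hb]⟩
  · ext w
    obtain ⟨⟨x, y⟩, rfl⟩ := e.symm.surjective w
    have hker : e.symm (x, y) ∈ LinearMap.ker (((f ∘ₗ p).coprod q') ∘ₗ e.toLinearMap) ↔
        f (p x) + q' y = 0 := by simp
    rw [hker]
    constructor
    · rintro ⟨v, hv⟩
      have hv : T (e v) = (x, y) := e.symm.injective hv
      obtain ⟨⟨a, b⟩, rfl⟩ := e.symm.surjective v
      rw [e.apply_symm_apply, hT, Prod.mk.injEq] at hv
      rw [← hv.1, ← hv.2, map_add, map_add, hρ, hpσ, map_zero, zero_add, neg_add_cancel]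
    · intro h
      have hy : q y = 0 := by
        rw [← hq', eq_neg_of_add_eq_zero_right h, map_neg, hfg.apply_apply_eq_zero, neg_zero]
      rw [← LinearMap.mem_ker, ← hτq] at hy
      obtain ⟨b, rfl⟩ := hy
      have hx : p (x - ρ b) = 0 := hf (by rw [map_sub, map_sub, hρ, sub_neg_eq_add, h, map_zero])
      rw [← LinearMap.mem_ker, ← hσp] at hx
      obtain ⟨a, ha⟩ := hx
      exact ⟨e.symm (a, b), by simp [hT, ha]⟩
  · intro v hv
    obtain ⟨⟨x, y⟩, rfl⟩ := e.symm.surjective v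
    rw [← he] at hv ⊢
    simp only [LinearMap.comp_apply, LinearEquiv.coe_coe, e.apply_symm_apply, hT,
      Pi.add_apply, map_add] at hv ⊢
    have hy := hτ₁ y hv.2
    refine ⟨hσ₁ x fun j => ?_, hy⟩
    simpa [aug_map_apply_eq_zero ρ hy] using hv.1 j
  · intro v
    obtain ⟨⟨x, y⟩, rfl⟩ := e.symm.surjective v
    obtain ⟨b, hb⟩ := hτ₂ y
    obtain ⟨a, ha⟩ := hσ₂ (x - ρ b)
    refine ⟨e.symm (a, b), (he _).mp ?_⟩
    simp only [map_sub, LinearMap.comp_apply, LinearEquiv.coe_coe, e.apply_symm_apply, hT]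
    refine ⟨fun j => ?_, hb⟩
    rw [← ha j]
    simp only [Prod.fst_sub, sub_sub, add_comm]

end IsFlkField

end LinkModule

section Simple

variable {μ : ℕ} {k : Type*} [Field k] {M : Type*} [AddCommGroup M] [Module (GR μ k) M]

/-- The preimage of a link submodule of the quotient `Q / P` of link modules is a link module. -/
theorem IsFlkField.comap_mkQ {P Q : Submodule (GR μ k) M} (hPQ : P ≤ Q)
    (hP : IsFlkField μ k P) {N : Submodule (GR μ k) (Q ⧸ P.comap Q.subtype)}
    (hN : IsFlkField μ k N) :
    IsFlkField μ k ((N.comap (P.comap Q.subtype).mkQ).map Q.subtype) := by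
  set K := N.comap (P.comap Q.subtype).mkQ with hK
  have hPK : ∀ x : P, Submodule.inclusion hPQ x ∈ K := fun x => by
    have : (P.comap Q.subtype).mkQ (Submodule.inclusion hPQ x) = 0 := by
      rw [Submodule.mkQ_apply, Submodule.Quotient.mk_eq_zero]
      exact x.2
    rw [hK, Submodule.mem_comap, this]
    exact zero_mem N
  have hK' : IsFlkField μ k K := by
    refine IsFlkField.of_exact (f := (Submodule.inclusion hPQ).codRestrict K hPK)
      (g := (P.comap Q.subtype).mkQ.restrict fun x hx => hx) ?_ ?_ ?_ hP hN
    · intro x y hxy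
      exact Submodule.inclusion_injective hPQ (congrArg Subtype.val hxy)
    · rintro ⟨y, hy⟩
      obtain ⟨x, rfl⟩ := (P.comap Q.subtype).mkQ_surjective y
      exact ⟨⟨x, hy⟩, rfl⟩
    · rintro ⟨x, hx⟩
      rw [Subtype.ext_iff, LinearMap.coe_restrict_apply, Submodule.coe_zero, Submodule.mkQ_apply,
        Submodule.Quotient.mk_eq_zero]
      constructor
      · exact fun h => ⟨⟨x, h⟩, rfl⟩
      · rintro ⟨y, hy⟩
        have hyx : (y : M) = x := congrArg (fun z : K => ((z : Q) : M)) hy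
        change (x : M) ∈ P
        exact hyx ▸ y.2
  exact hK'.of_equiv (Submodule.equivMapOfInjective _ Q.injective_subtype K)

theorem simple_quotient_of_covBy {P Q : {N : Submodule (GR μ k) M // IsFlkField μ k N}}
    (h : P ⋖ Q) :
    Nontrivial (Q.1 ⧸ P.1.comap Q.1.subtype) ∧
      ∀ N : Submodule (GR μ k) (Q.1 ⧸ P.1.comap Q.1.subtype),
        IsFlkField μ k N → N = ⊥ ∨ N = ⊤ := by
  have hPQ : P.1 ≤ Q.1 := h.le
  refine ⟨Submodule.Quotient.nontrivial_iff.mpr fun htop => ?_, fun N hN => ?_⟩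
  · exact h.lt.not_ge (Submodule.comap_subtype_eq_top.mp htop)
  · let L : {N : Submodule (GR μ k) M // IsFlkField μ k N} := ⟨_, P.2.comap_mkQ hPQ hN⟩
    have hPL : P ≤ L := fun x hx => ⟨⟨x, hPQ hx⟩, by
      have : (P.1.comap Q.1.subtype).mkQ ⟨x, hPQ hx⟩ = 0 := by
        rw [Submodule.mkQ_apply, Submodule.Quotient.mk_eq_zero]
        exact hx
      simp only [SetLike.mem_coe, Submodule.mem_comap, this, zero_mem], rfl⟩
    have hLQ : L ≤ Q := Submodule.map_subtype_le _ _
    have hcomap : L.1.comap Q.1.subtype = N.comap (P.1.comap Q.1.subtype).mkQ :=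
      Submodule.comap_map_eq_of_injective Q.1.injective_subtype _
    rcases h.eq_or_eq hPL hLQ with hL | hL
    · left
      rw [← Submodule.map_comap_eq_of_surjective (Submodule.mkQ_surjective _) N, ← hcomap, hL,
        Submodule.mkQ_map_self]
    · right
      rw [← Submodule.map_comap_eq_of_surjective (Submodule.mkQ_surjective _) N, ← hcomap, hL,
        Submodule.comap_subtype_self, Submodule.map_top, Submodule.range_mkQ]

end Simple

/-- Every `M ∈ Flk(k)` satisfies the ascending and descending chain
conditions on submodules lying in `Flk(k)`, and admits a finite composition series in
`Flk(k)` whose successive quotients are simple in `Flk(k)`. -/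
theorem statement7 (μ : ℕ) (k : Type*) [Field k]
    (M : Type*) [AddCommGroup M] [Module (GR μ k) M] (hM : IsFlkField μ k M) :
    (∀ N : ℕ → Submodule (GR μ k) M, (∀ i, N i ≤ N (i + 1)) →
      (∀ i, IsFlkField μ k (N i)) → ∃ n, ∀ m, n ≤ m → N m = N n) ∧
    (∀ N : ℕ → Submodule (GR μ k) M, (∀ i, N (i + 1) ≤ N i) →
      (∀ i, IsFlkField μ k (N i)) → ∃ n, ∀ m, n ≤ m → N m = N n) ∧
    ∃ (s : ℕ) (F : ℕ → Submodule (GR μ k) M),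
      F 0 = ⊥ ∧ F s = ⊤ ∧ (∀ i, i < s → F i ≤ F (i + 1)) ∧
      (∀ i, i ≤ s → IsFlkField μ k (F i)) ∧
      (∀ i, i < s →
        Nontrivial ((F (i + 1)) ⧸ (Submodule.comap (F (i + 1)).subtype (F i))) ∧
        (∀ N : Submodule (GR μ k)
            ((F (i + 1)) ⧸ (Submodule.comap (F (i + 1)).subtype (F i))),
          IsFlkField μ k N → N = ⊥ ∨ N = ⊤)) := by
  let : Module k M := Module.compHom M (algebraMap k (GR μ k))
  have : IsScalarTower k (GR μ k) M := IsScalarTower.of_algebraMap_smul fun _ _ => rfl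
  have := hM.finite
  obtain ⟨δ, hδ⟩ := exists_isFoxInverse (k := k) hM.bijective_sum
  obtain ⟨V, hV, hdetect⟩ := hδ.exists_fg_detecting adjoin_gen
  have : Module.Finite k V := Module.Finite.of_fg hV
  have hstable : ∀ N : Submodule (GR μ k) M, IsFlkField μ k N → ∀ j, ∀ x ∈ N, δ j x ∈ N := by
    intro N hN j x hx
    obtain ⟨y, hy⟩ := hN.bijective_sum.2 ⟨x, hx⟩
    have hy : ∑ i, ((gen μ k i : GR μ k) - 1) • (y i : M) = x := by
      simpa using congrArg Subtype.val hy
    rw [← hy, hδ.apply_sum]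
    exact (y j).2
  let φ : {N : Submodule (GR μ k) M // IsFlkField μ k N} → Submodule k V := fun N =>
    (N.1.restrictScalars k).comap V.subtype
  have hφ : StrictMono φ := by
    refine Monotone.strictMono_of_injective (fun N N' h x hx => h hx) fun N N' h => ?_
    have key : ∀ N N' : {N : Submodule (GR μ k) M // IsFlkField μ k N}, φ N ≤ φ N' → N ≤ N' :=
      fun N N' h => (hdetect N.1 (hstable N.1 N.2)).trans <| Submodule.span_le.mpr fun x hx =>
        h (x := ⟨x, hx.2⟩) hx.1
    exact le_antisymm (key _ _ h.le) (key _ _ h.ge)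
  have := hφ.wellFoundedLT
  have := hφ.wellFoundedGT
  refine ⟨fun N hN hflk => ?_, fun N hN hflk => ?_, ?_⟩
  · obtain ⟨n, hn⟩ := WellFoundedGT.monotone_chain_condition
      ⟨fun i => (⟨N i, hflk i⟩ : {N : Submodule (GR μ k) M // IsFlkField μ k N}),
        monotone_nat_of_le_succ hN⟩
    exact ⟨n, fun m hm => (congrArg Subtype.val (hn m hm)).symm⟩
  · obtain ⟨n, hn⟩ := WellFoundedLT.antitone_chain_condition
      (f := fun i => (⟨N i, hflk i⟩ : {N : Submodule (GR μ k) M // IsFlkField μ k N}))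
      (antitone_nat_of_succ_le hN)
    exact ⟨n, fun m hm => (congrArg Subtype.val (hn m hm)).symm⟩
  · obtain ⟨F, hF0, s, hFs, hF⟩ := exists_covBy_seq_of_wellFoundedLT_wellFoundedGT_of_le
      (x := (⟨⊥, .of_subsingleton⟩ : {N : Submodule (GR μ k) M // IsFlkField μ k N}))
      (y := ⟨⊤, hM.of_equiv Submodule.topEquiv.symm⟩)
      (show (⊥ : Submodule (GR μ k) M) ≤ ⊤ from bot_le)
    exact ⟨s, fun i => (F i).1, congrArg Subtype.val hF0, congrArg Subtype.val hFs,
      fun i hi => (hF i hi).le, fun i _ => (F i).2,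
      fun i hi => simple_quotient_of_covBy (hF i hi)⟩
end
end
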